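/- Let q ∈ ℂ with q ≠ 0 and q^m ≠ 1 for every positive integer m. Let A₁₁, A₁₂, A₂₁, A₂₂ be a representation of GL_q(2,ℂ) by 4×4 complex matrices with nontrivial perturbation, i.e. A₁₂A₂₁ ≠ 0, and suppose the quantum determinant D = A₁₁A₂₂ − qA₁₂A₂₁ is not a scalar multiple of the identity matrix (equivalently, the corresponding inner action is not an action of SL_q(2,ℂ)). Then the space of invariants of the inner action, namely the centralizer {v ∈ M₄(ℂ) : vA_ij = A_ij v for all i, j ∈ {1,2}}, is exactly the two-dimensional linear span of the identity matrix and D. -/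

import Mathlib

/-- A representation of the algebra `GL_q(2,ℂ)` by `n×n` complex matrices:
the six defining relations together with invertibility of the quantum
determinant `A₁₁A₂₂ − qA₁₂A₂₁`. -/
def IsGLqRep {n : ℕ} (q : ℂ) (A₁₁ A₁₂ A₂₁ A₂₂ : Matrix (Fin n) (Fin n) ℂ) : Prop :=
  A₁₁ * A₁₂ = q • (A₁₂ * A₁₁) ∧
  A₁₁ * A₂₁ = q • (A₂₁ * A₁₁) ∧
  A₁₂ * A₂₂ = q • (A₂₂ * A₁₂) ∧
  A₂₁ * A₂₂ = q • (A₂₂ * A₂₁) ∧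
  A₁₂ * A₂₁ = A₂₁ * A₁₂ ∧
  A₁₁ * A₂₂ - A₂₂ * A₁₁ = (q - q⁻¹) • (A₁₂ * A₂₁) ∧
  IsUnit (A₁₁ * A₂₂ - q • (A₁₂ * A₂₁))

open Module

/-- The nilpotent Jordan block of size `4`. -/
def jordan4 : Matrix (Fin 4) (Fin 4) ℂ := !![0,0,0,0; 1,0,0,0; 0,1,0,0; 0,0,1,0]

/-- The nilpotent Jordan matrix with blocks of sizes `3` and `1`. -/
def jordan31 : Matrix (Fin 4) (Fin 4) ℂ := !![0,0,0,0; 1,0,0,0; 0,1,0,0; 0,0,0,0]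

lemma eq_of_q_commute_jordan31 {v : Matrix (Fin 4) (Fin 4) ℂ} {q : ℂ} (hq : q ≠ 0)
    (h : v * jordan31 = q • (jordan31 * v)) :
    ∃ p0 p1 p2 p3 r t : ℂ,
      v = !![p0,0,0,0; p1,q*p0,0,0; p2,q*p1,q^2*p0,r; p3,0,0,t] := by
  have H := fun i j => congrFun (congrFun h i) j
  refine ⟨v 0 0, v 1 0, v 2 0, v 3 0, v 2 3, v 3 3, ?_⟩
  simp [jordan31, Matrix.mul_apply, Matrix.vecMul, dotProduct, Fin.sum_univ_four,
    Fin.forall_fin_succ] at H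
  ext i j
  fin_cases i <;> fin_cases j <;> simp <;> grind

lemma eq_of_q_commute_jordan4 {v : Matrix (Fin 4) (Fin 4) ℂ} {q : ℂ}
    (h : v * jordan4 = q • (jordan4 * v)) :
    ∃ p0 p1 p2 p3 : ℂ,
      v = !![p0,0,0,0; p1,q*p0,0,0; p2,q*p1,q^2*p0,0; p3,q*p2,q^2*p1,q^3*p0] := by
  have H := fun i j => congrFun (congrFun h i) j
  refine ⟨v 0 0, v 1 0, v 2 0, v 3 0, ?_⟩
  simp [jordan4, Matrix.mul_apply, Matrix.vecMul, dotProduct, Fin.sum_univ_four,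
    Fin.forall_fin_succ] at H
  ext i j
  fin_cases i <;> fin_cases j <;> simp <;> grind

lemma eq_smul_one_of_commute_jordan4 {q : ℂ} (hq : ∀ m : ℕ, 0 < m → q ^ m ≠ 1)
    {a D : Matrix (Fin 4) (Fin 4) ℂ} (ha : IsUnit a) (hae : a * jordan4 = q • (jordan4 * a))
    (hDe : D * jordan4 = jordan4 * D) (hDa : D * a = a * D) : ∃ c : ℂ, D = c • 1 := by
  obtain ⟨x0, x1, x2, x3, rfl⟩ := eq_of_q_commute_jordan4 hae
  obtain ⟨p0, p1, p2, p3, rfl⟩ := eq_of_q_commute_jordan4 (q := 1) (by simpa using hDe)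
  have hx : x0 ≠ 0 := by
    rintro rfl
    rw [Matrix.isUnit_iff_isUnit_det] at ha
    simp [Matrix.det_succ_row_zero, Fin.sum_univ_succ] at ha
  have h1 := congrFun (congrFun hDa 1) 0
  have h2 := congrFun (congrFun hDa 2) 0
  have h3 := congrFun (congrFun hDa 3) 0
  simp at h1 h2 h3
  have e1 : p1 = 0 := by
    have : p1 * (x0 * (q ^ 1 - 1)) = 0 := by linear_combination -h1
    simpa [hx, sub_eq_zero, by simpa using hq 1 one_pos] using this
  subst e1
  have e2 : p2 = 0 := by
    have : p2 * (x0 * (q ^ 2 - 1)) = 0 := by linear_combination -h2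
    simpa [hx, sub_eq_zero, hq 2 two_pos] using this
  subst e2
  have e3 : p3 = 0 := by
    have : p3 * (x0 * (q ^ 3 - 1)) = 0 := by linear_combination -h3
    simpa [hx, sub_eq_zero, hq 3 three_pos] using this
  subst e3
  refine ⟨p0, ?_⟩
  ext i j
  fin_cases i <;> fin_cases j <;> simp

lemma eq_smul_one_add_smul_of_commute_jordan31 {q : ℂ} (hq0 : q ≠ 0) (hq : q ^ 2 ≠ 1)
    {a D v : Matrix (Fin 4) (Fin 4) ℂ} (ha : IsUnit a) (hae : a * jordan31 = q • (jordan31 * a))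
    (hDe : D * jordan31 = jordan31 * D) (hDa : D * a = a * D) (hD : ∀ c : ℂ, D ≠ c • 1)
    (hve : v * jordan31 = jordan31 * v) (hva : v * a = a * v) (hvD : v * D = D * v) :
    ∃ s t : ℂ, v = s • 1 + t • D := by
  obtain ⟨x0, x1, x2, x3, y, z, rfl⟩ := eq_of_q_commute_jordan31 hq0 hae
  obtain ⟨d0, d1, d2, d3, R, dt, rfl⟩ := eq_of_q_commute_jordan31 one_ne_zero (by simpa using hDe)
  obtain ⟨p0, p1, p2, p3, r, t, rfl⟩ := eq_of_q_commute_jordan31 one_ne_zero (by simpa using hve)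
  have hx : x0 ≠ 0 := by
    rintro rfl
    rw [Matrix.isUnit_iff_isUnit_det] at ha
    simp [Matrix.det_succ_row_zero, Fin.sum_univ_succ] at ha
  have hq1 : q ≠ 1 := by rintro rfl; simp at hq
  have key : ∀ p0 p1 p2 p3 r t : ℂ,
      !![p0,0,0,0; p1,1*p0,0,0; p2,1*p1,1^2*p0,r; p3,0,0,t] *
        !![x0,0,0,0; x1,q*x0,0,0; x2,q*x1,q^2*x0,y; x3,0,0,z] =
        !![x0,0,0,0; x1,q*x0,0,0; x2,q*x1,q^2*x0,y; x3,0,0,z] *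
        !![p0,0,0,0; p1,1*p0,0,0; p2,1*p1,1^2*p0,r; p3,0,0,t] →
      p1 = 0 ∧ p2 * (x0 * (1 - q ^ 2)) = p3 * y - r * x3 := by
    intro p0 p1 p2 p3 r t h
    have h1 := congrFun (congrFun h 1) 0
    have h2 := congrFun (congrFun h 2) 0
    simp at h1 h2
    have e1 : p1 = 0 := by
      have : p1 * (x0 * (q - 1)) = 0 := by linear_combination -h1
      simpa [hx, sub_eq_zero, hq1] using this
    subst e1
    exact ⟨rfl, by linear_combination h2⟩
  obtain ⟨rfl, k1⟩ := key _ _ _ _ _ _ hva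
  obtain ⟨rfl, k2⟩ := key _ _ _ _ _ _ hDa
  have hc : x0 * (1 - q ^ 2) ≠ 0 := mul_ne_zero hx (sub_ne_zero.2 hq.symm)
  have g1 := congrFun (congrFun hvD 3) 0
  have g2 := congrFun (congrFun hvD 2) 3
  have g3 := congrFun (congrFun hvD 2) 0
  simp at g1 g2 g3
  have fin : ∀ k : ℂ, p0 - t = k * (d0 - dt) → p3 = k * d3 → r = k * R →
      ∃ s t' : ℂ, !![p0,0,0,0; 0,1*p0,0,0; p2,1*0,1^2*p0,r; p3,0,0,t] = s • 1 + t' •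
        !![d0,0,0,0; 0,1*d0,0,0; d2,1*0,1^2*d0,R; d3,0,0,dt] := by
    intro k hk1 hk2 hk3
    have hk4 : p2 = k * d2 := by
      apply mul_right_cancel₀ hc
      rw [k1, mul_assoc, k2, hk2, hk3]; ring
    refine ⟨p0 - k * d0, k, ?_⟩
    ext i j
    fin_cases i <;> fin_cases j <;> simp [hk2, hk3, hk4]
    linear_combination -hk1
  by_cases c1 : d0 - dt = 0
  · by_cases c2 : d3 = 0
    · by_cases c3 : R = 0
      · exfalso
        apply hD d0
        subst c2 c3
        have : d2 = 0 := by simpa [hc, hx, sub_eq_zero, hq.symm] using k2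
        rw [sub_eq_zero] at c1
        subst c1 this
        ext i j
        fin_cases i <;> fin_cases j <;> simp
      · refine fin (r / R) ?_ ?_ ?_ <;> field_simp <;> grind
    · refine fin (p3 / d3) ?_ ?_ ?_ <;> field_simp <;> grind
  · refine fin ((p0 - t) / (d0 - dt)) ?_ ?_ ?_ <;> field_simp <;> grind

lemma toMatrixAlgEquiv_eq {ι K V : Type*} [Fintype ι] [DecidableEq ι] [Field K] [AddCommGroup V]
    [Module K V] (b : Basis ι K V) (f : End K V) (M : Matrix ι ι K)
    (h : ∀ j, f (b j) = ∑ i, M i j • b i) : LinearMap.toMatrixAlgEquiv b f = M := by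
  ext i j
  rw [LinearMap.toMatrixAlgEquiv_apply, h, b.repr_sum_self]

lemma exists_basis_toMatrix_eq_jordan {V : Type*} [AddCommGroup V] [Module ℂ V]
    (hV : finrank ℂ V = 4)
    {f : End ℂ V} (hf4 : f ^ 4 = 0) (hf2 : f ^ 2 ≠ 0) :
    ∃ b : Basis (Fin 4) ℂ V, LinearMap.toMatrixAlgEquiv b f = jordan4 ∨
      LinearMap.toMatrixAlgEquiv b f = jordan31 := by
  have hc : Fintype.card (Fin 4) = finrank ℂ V := by simp [hV]
  have : FiniteDimensional ℂ V := .of_finrank_pos (by omega)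
  by_cases h3 : f ^ 3 = 0
  · have h3' (x) : f (f (f x)) = 0 := LinearMap.congr_fun h3 x
    obtain ⟨u, hu⟩ : ∃ u, f (f u) ≠ 0 := by
      by_contra! h
      exact hf2 (LinearMap.ext h)
    have li : LinearIndependent ℂ ![u, f u, f (f u)] := by
      rw [Fintype.linearIndependent_iff]
      intro g hg
      simp only [Fin.sum_univ_three, Matrix.cons_val] at hg
      have g0 : g 0 = 0 := by simpa [h3', hu] using congrArg (fun x => f (f x)) hg
      have g1 : g 1 = 0 := by simpa [h3', hu, g0] using congrArg (fun x => f x) hg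
      have g2 : g 2 = 0 := by simpa [hu, g0, g1] using hg
      intro i; fin_cases i <;> assumption
    obtain ⟨x, hx⟩ := exists_linearIndependent_cons_of_lt_finrank li (by omega)
    let b₀ := basisOfLinearIndependentOfCardEqFinrank hx hc
    rw [Fintype.linearIndependent_iff] at hx
    have hfx := (b₀.sum_repr (f x)).symm
    generalize b₀.repr (f x) = c at hfx
    simp [b₀, Fin.sum_univ_four] at hfx
    have e3 := h3' x
    simp [hfx, h3'] at e3
    have k := hx ![c 0 ^ 3, c 0 ^ 2 * c 1, c 0 ^ 2 * c 2 + c 0 * c 1,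
      c 0 ^ 2 * c 3 + c 0 * c 2 + c 1] (by
        simp [Fin.sum_univ_four]
        rw [← e3]
        module)
    have c0 : c 0 = 0 := by simpa using k 0
    have c1 : c 1 = 0 := by simpa [c0] using k 3
    simp [c0, c1] at hfx
    have li' : LinearIndependent ℂ ![u, f u, f (f u), x - c 2 • u - c 3 • f u] := by
      rw [Fintype.linearIndependent_iff]
      intro g hg
      simp only [Fin.sum_univ_four, Matrix.cons_val] at hg
      have k := hx ![g 3, g 0 - g 3 * c 2, g 1 - g 3 * c 3, g 2] (by
        simp [Fin.sum_univ_four]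
        rw [← hg]
        module)
      have g3 : g 3 = 0 := k 0
      have g0 : g 0 = 0 := by simpa [g3] using k 1
      have g1 : g 1 = 0 := by simpa [g3] using k 2
      have g2 : g 2 = 0 := k 3
      intro i; fin_cases i <;> assumption
    refine ⟨basisOfLinearIndependentOfCardEqFinrank li' hc, Or.inr ?_⟩
    apply toMatrixAlgEquiv_eq
    intro j
    fin_cases j <;> simp [Fin.sum_univ_four, jordan31, h3', hfx]
  · obtain ⟨u, hu⟩ : ∃ u, f (f (f u)) ≠ 0 := by
      by_contra! h
      exact h3 (LinearMap.ext h)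
    have h4 (x) : f (f (f (f x))) = 0 := LinearMap.congr_fun hf4 x
    have li : LinearIndependent ℂ ![u, f u, f (f u), f (f (f u))] := by
      rw [Fintype.linearIndependent_iff]
      intro g hg
      simp only [Fin.sum_univ_four, Matrix.cons_val] at hg
      have g0 : g 0 = 0 := by simpa [h4, hu] using congrArg (fun x => f (f (f x))) hg
      have g1 : g 1 = 0 := by simpa [h4, hu, g0] using congrArg (fun x => f (f x)) hg
      have g2 : g 2 = 0 := by simpa [h4, hu, g0, g1] using congrArg (fun x => f x) hg
      have g3 : g 3 = 0 := by simpa [hu, g0, g1, g2] using hg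
      intro i; fin_cases i <;> assumption
    refine ⟨basisOfLinearIndependentOfCardEqFinrank li hc, Or.inl ?_⟩
    apply toMatrixAlgEquiv_eq
    intro j
    fin_cases j <;> simp [Fin.sum_univ_four, jordan4, h4]

lemma pow_finrank_eq_zero {K V : Type*} [Field K] [AddCommGroup V] [Module K V]
    [FiniteDimensional K V] {f : End K V} (hf : IsNilpotent f) : f ^ finrank K V = 0 := by
  obtain ⟨m, hm⟩ := hf
  have := End.ker_pow_le_ker_pow_finrank f m
  rwa [hm, LinearMap.ker_zero, top_le_iff, LinearMap.ker_eq_top] at this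

lemma isNilpotent_of_q_commute {K R : Type*} [Field K] [Ring R] [Algebra K R]
    [FiniteDimensional K R] {q : K} (hq0 : q ≠ 0) (hq : ∀ m : ℕ, 0 < m → q ^ m ≠ 1) {a e : R}
    (ha : IsUnit a) (hae : a * e = q • (e * a)) : IsNilpotent e := by
  obtain ⟨a, rfl⟩ := ha
  by_contra h
  simp only [IsNilpotent, not_exists] at h
  have hpow (i : ℕ) : a * e ^ i = q ^ i • (e ^ i * a) := by
    induction i with
    | zero => simp
    | succ i ih =>
      rw [pow_succ, ← mul_assoc, ih, smul_mul_assoc, mul_assoc, hae, mul_smul_comm, smul_smul,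
        ← pow_succ, ← mul_assoc]
  have hinj : Function.Injective (fun i : ℕ => q ^ i) := by
    intro i j h
    wlog hij : i < j generalizing i j
    · by_contra hne
      exact hne (this h.symm (by omega)).symm
    refine absurd ?_ (hq (j - i) (by omega))
    simp only at h
    rw [← Nat.add_sub_of_le hij.le, pow_add] at h
    simpa [hq0] using h
  have li := End.eigenvectors_linearIndependent'
    (LinearMap.mulLeft K (a : R) ∘ₗ LinearMap.mulRight K (↑a⁻¹ : R))
    (fun i : ℕ => q ^ i) hinj (fun i => e ^ i) (fun i => by
      rw [End.hasEigenvector_iff, End.mem_eigenspace_iff]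
      refine ⟨?_, h i⟩
      simp [← mul_assoc, hpow])
  exact not_finite_iff_infinite.2 (inferInstance : Infinite ℕ) li.finite

lemma isUnit_of_qdet_isUnit {K V : Type*} [Field K] [AddCommGroup V] [Module K V]
    [FiniteDimensional K V] {q : K} (hq : ∀ m : ℕ, 0 < m → q ^ m ≠ 1)
    {a d N D : End K V} (had : a * d = D + q • N) (hda : q • (d * a) = q • D + N)
    (hNd : N * d = q ^ 2 • (d * N)) (hDd : D * d = d * D) (hDa : D * a = a * D)
    (hD : IsUnit D) : IsUnit a := by
  have hDi : Function.Injective D :=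
    LinearMap.ker_eq_bot.1 ((LinearMap.isUnit_iff_ker_eq_bot D).1 hD)
  rw [LinearMap.isUnit_iff_ker_eq_bot, Submodule.eq_bot_iff]
  intro v hv
  rw [LinearMap.mem_ker] at hv
  have had' (x) : a (d x) = D x + q • N x := LinearMap.congr_fun had x
  have hNd' (x) : N (d x) = q ^ 2 • d (N x) := LinearMap.congr_fun hNd x
  have hDd' (x) : D (d x) = d (D x) := LinearMap.congr_fun hDd x
  have hDa' (x) : D (a x) = a (D x) := LinearMap.congr_fun hDa x
  have hNv : N v = -(q • D v) := by
    have := LinearMap.congr_fun hda v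
    simp [hv] at this
    exact (eq_neg_of_add_eq_zero_right this.symm)
  have hN (j : ℕ) : N ((d ^ j) v) = -(q ^ (2 * j + 1) • D ((d ^ j) v)) := by
    induction j with
    | zero => simpa using hNv
    | succ j ih =>
      rw [pow_succ', Module.End.mul_apply, hNd', ih, hDd', map_neg, map_smul]
      module
  have hstep (j : ℕ) : a ((d ^ (j + 1)) v) = (1 - q ^ (2 * j + 2)) • D ((d ^ j) v) := by
    rw [pow_succ', Module.End.mul_apply, had', hN]
    module
  have hcomm (k : ℕ) (x) : (a ^ k) (D x) = D ((a ^ k) x) :=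
    (LinearMap.congr_fun ((show Commute D a from hDa).pow_right k) x).symm
  have hz (k : ℕ) : (a ^ (k + 1)) ((d ^ k) v) = 0 := by
    induction k with
    | zero => simpa using hv
    | succ k ih => rw [pow_succ, Module.End.mul_apply, hstep, map_smul, hcomm, ih]; simp
  have hnz (k : ℕ) (h : (a ^ k) ((d ^ k) v) = 0) : v = 0 := by
    induction k with
    | zero => simpa using h
    | succ k ih =>
      rw [pow_succ, Module.End.mul_apply, hstep, map_smul, hcomm, smul_eq_zero,
        map_eq_zero_iff D hDi, sub_eq_zero] at h
      exact ih (h.resolve_left (hq _ (by omega)).symm)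
  obtain ⟨k, -, hk⟩ := End.exists_ker_pow_eq_ker_pow_succ a
  refine hnz k (LinearMap.mem_ker.1 ?_)
  rw [hk]
  exact hz k

lemma eq_smul_one_add_smul {q : ℂ} (hq0 : q ≠ 0) (hq : ∀ m : ℕ, 0 < m → q ^ m ≠ 1)
    {a e D v : Matrix (Fin 4) (Fin 4) ℂ} (ha : IsUnit a) (hae : a * e = q • (e * a))
    (he : e ^ 2 ≠ 0) (hDe : D * e = e * D) (hDa : D * a = a * D) (hD : ∀ c : ℂ, D ≠ c • 1)
    (hve : v * e = e * v) (hva : v * a = a * v) (hvD : v * D = D * v) :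
    ∃ s t : ℂ, v = s • 1 + t • D := by
  have hnil := (isNilpotent_of_q_commute hq0 hq ha hae).map (Matrix.toLinAlgEquiv' (R := ℂ))
  obtain ⟨b, hb⟩ := exists_basis_toMatrix_eq_jordan (V := Fin 4 → ℂ) (by simp)
    (f := Matrix.toLinAlgEquiv' e) (by simpa using pow_finrank_eq_zero hnil)
    (by rwa [← map_pow, Ne, map_eq_zero_iff _ (AlgEquiv.injective _)])
  let φ := (Matrix.toLinAlgEquiv' (R := ℂ)).trans (LinearMap.toMatrixAlgEquiv b)
  have tr {x y : Matrix (Fin 4) (Fin 4) ℂ} (h : x * y = y * x) : φ x * φ y = φ y * φ x := by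
    rw [← map_mul, h, map_mul]
  have hφ : φ a * φ e = q • (φ e * φ a) := by rw [← map_mul, hae, map_smul, map_mul]
  have hφD (c : ℂ) : φ D ≠ c • 1 := fun h => hD c <| φ.injective <| by simpa using h
  have hφe : φ e = jordan4 ∨ φ e = jordan31 := hb
  rcases hφe with h | h
  · obtain ⟨c, hc⟩ := eq_smul_one_of_commute_jordan4 hq (ha.map φ) (h ▸ hφ) (h ▸ tr hDe) (tr hDa)
    exact absurd hc (hφD c)
  · obtain ⟨s, t, hst⟩ := eq_smul_one_add_smul_of_commute_jordan31 hq0 (hq 2 two_pos)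
      (ha.map φ) (h ▸ hφ) (h ▸ tr hDe) (tr hDa)
      hφD (h ▸ tr hve) (tr hva) (tr hvD)
    exact ⟨s, t, φ.injective <| by simpa using hst⟩

/-- for a representation of `GL_q(2,ℂ)` in `M₄(ℂ)` with
nontrivial perturbation (`A₁₂A₂₁ ≠ 0`) whose quantum determinant `D` is not
scalar, the algebra of invariants of the inner action (the centralizer of the
`A_ij`) is exactly the two-dimensional span of `1` and `D`. -/
theorem invariants_eq_span_one_qdet (q : ℂ) (hq0 : q ≠ 0)
    (hq : ∀ m : ℕ, 0 < m → q ^ m ≠ 1)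
    (A₁₁ A₁₂ A₂₁ A₂₂ : Matrix (Fin 4) (Fin 4) ℂ)
    (hrep : IsGLqRep q A₁₁ A₁₂ A₂₁ A₂₂)
    (hpert : A₁₂ * A₂₁ ≠ 0)
    (hD : ∀ c : ℂ,
      A₁₁ * A₂₂ - q • (A₁₂ * A₂₁) ≠ c • (1 : Matrix (Fin 4) (Fin 4) ℂ)) :
    {v : Matrix (Fin 4) (Fin 4) ℂ |
        v * A₁₁ = A₁₁ * v ∧ v * A₁₂ = A₁₂ * v ∧
        v * A₂₁ = A₂₁ * v ∧ v * A₂₂ = A₂₂ * v} =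
      (Submodule.span ℂ
        ({1, A₁₁ * A₂₂ - q • (A₁₂ * A₂₁)} : Set (Matrix (Fin 4) (Fin 4) ℂ)) :
        Set (Matrix (Fin 4) (Fin 4) ℂ)) ∧
    Module.finrank ℂ
      (Submodule.span ℂ
        ({1, A₁₁ * A₂₂ - q • (A₁₂ * A₂₁)} : Set (Matrix (Fin 4) (Fin 4) ℂ))) = 2 := by
  obtain ⟨hab, hac, hbd, hcd, hbc, had, hu⟩ := hrep
  generalize A₁₁ = a, A₁₂ = b, A₂₁ = c, A₂₂ = d at *
  generalize hDdef : a * d - q • (b * c) = D at *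
  have had₁ : a * d = D + q • (b * c) := by rw [← hDdef]; abel
  have hda₁ : d * a = D + q⁻¹ • (b * c) := by
    rw [sub_eq_iff_eq_add'] at had
    rw [← hDdef, had]
    module
  have haN : a * (b * c) = q ^ 2 • (b * c * a) := by
    rw [← mul_assoc, hab, smul_mul_assoc, mul_assoc, hac, mul_smul_comm, smul_smul, sq, mul_assoc]
  have hNd : b * c * d = q ^ 2 • (d * (b * c)) := by
    rw [mul_assoc, hcd, mul_smul_comm, ← mul_assoc, hbd, smul_mul_assoc, smul_smul, sq, mul_assoc]
  have hq2 : q⁻¹ * q ^ 2 = q := by field_simp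
  have hDa : D * a = a * D := by
    have h1 : a * d * a = D * a + q • (b * c * a) := by rw [had₁, add_mul, smul_mul_assoc]
    rw [mul_assoc, hda₁, mul_add, mul_smul_comm, haN, smul_smul, hq2] at h1
    exact (add_right_cancel h1).symm
  have hDd : D * d = d * D := by
    have h1 : d * a * d = D * d + q⁻¹ • (b * c * d) := by rw [hda₁, add_mul, smul_mul_assoc]
    rw [mul_assoc, had₁, mul_add, mul_smul_comm, hNd, smul_smul, hq2] at h1
    exact (add_right_cancel h1).symm
  have hD_comm {x : Matrix (Fin 4) (Fin 4) ℂ} (hax : a * x = q • (x * a))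
      (hxd : x * d = q • (d * x)) (hxN : Commute x (b * c)) : D * x = x * D := by
    have h1 : x * (a * d) = a * d * x := by
      apply smul_right_injective _ hq0
      simp only
      rw [← mul_assoc, ← smul_mul_assoc, ← hax, mul_assoc, hxd, mul_smul_comm, mul_assoc]
    rw [← hDdef, sub_mul, mul_sub, h1, smul_mul_assoc, mul_smul_comm, hxN.eq]
  have hbc' : Commute b c := hbc
  have hDb : D * b = b * D := hD_comm hab hbd ((Commute.refl b).mul_right hbc')
  have hDc : D * c = c * D := hD_comm hac hcd (hbc'.symm.mul_right (Commute.refl c))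
  have ha : IsUnit a := by
    let ψ := Matrix.toLinAlgEquiv' (R := ℂ) (n := Fin 4)
    have : IsUnit (ψ a) := by
      refine isUnit_of_qdet_isUnit hq (d := ψ d) (N := ψ (b * c)) (D := ψ D) ?_ ?_ ?_ ?_ ?_ (hu.map ψ)
      · simp only [← map_mul, ← map_smul, ← map_add, had₁]
      · simp only [← map_mul, ← map_smul, ← map_add, hda₁, smul_add, smul_smul,
          mul_inv_cancel₀ hq0, one_smul]
      · simp only [← map_mul, ← map_smul, hNd]
      · simp only [← map_mul, hDd]
      · simp only [← map_mul, hDa]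
    exact (MulEquiv.isUnit_map ψ).1 this
  obtain ⟨s, t, hst⟩ : ∃ s t : ℂ, (s • b + t • c) ^ 2 ≠ 0 := by
    by_contra! h
    have h1 := h 1 0
    have h2 := h 0 1
    have h3 := h 1 1
    simp only [one_smul, zero_smul, add_zero, zero_add] at h1 h2 h3
    rw [hbc'.add_sq, h1, h2, zero_add, add_zero, mul_assoc] at h3
    rw [two_mul, ← two_smul ℂ] at h3
    exact hpert (by simpa using h3)
  constructor
  · ext v
    simp only [Set.mem_ofPred_eq, SetLike.mem_coe, Submodule.mem_span_pair]
    constructor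
    · rintro ⟨hva, hvb, hvc, hvd⟩
      have hvD : v * D = D * v := by
        have h1 : Commute v a := hva
        have h2 : Commute v b := hvb
        have h3 : Commute v c := hvc
        have h4 : Commute v d := hvd
        rw [← hDdef]
        exact (h1.mul_right h4).sub_right ((h2.mul_right h3).smul_right q)
      obtain ⟨x, y, hxy⟩ := eq_smul_one_add_smul hq0 hq ha (e := s • b + t • c)
        (by simp only [mul_add, add_mul, mul_smul_comm, smul_mul_assoc, hab, hac, smul_add,
              smul_comm q])
        hst
        (by simp only [mul_add, add_mul, mul_smul_comm, smul_mul_assoc, hDb, hDc])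
        hDa hD
        (by simp only [mul_add, add_mul, mul_smul_comm, smul_mul_assoc, hvb, hvc])
        hva hvD
      exact ⟨x, y, hxy.symm⟩
    · rintro ⟨x, y, rfl⟩
      simp [mul_add, add_mul, hDa, hDb, hDc, hDd]
  · have li : LinearIndependent ℂ ![(1 : Matrix (Fin 4) (Fin 4) ℂ), D] :=
      (LinearIndependent.pair_iff' one_ne_zero).2 fun x => (hD x).symm
    rw [← Matrix.range_cons_cons_empty (1 : Matrix (Fin 4) (Fin 4) ℂ) D ![]]
    simpa only [Fintype.card_fin] using finrank_span_eq_card li
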